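/- arXiv:1007.1489 — 8 statements merged into one kernel-verified Lean document; each statement's English description precedes it below -/
import Mathlib

section
/- Let G be a pro-p group, W a valuation on G, and H a closed subgroup of G. Then the W-index of H satisfies [G:H]_W = sup { [G:U]_W : U an open subgroup of G with H ≤ U }, where the supremum is taken in [1,∞]; moreover [G:U]_W ≤ [G:U']_W whenever U' ≤ U are open subgroups containing H, so this supremum is the limit of [G:U]_W along the directed family of open subgroups containing H ordered by reverse inclusion. -/
open scoped ENNReal

/-- A pro-`p` group: compact, Hausdorff, totally disconnected, and every open
normal subgroup has index a power of `p`.  (The ambient `TopologicalGroup`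
structure is carried by instances.) -/
def IsProPGroup (p : ℕ) (G : Type*) [Group G] [TopologicalSpace G] : Prop :=
  CompactSpace G ∧ T2Space G ∧ TotallyDisconnectedSpace G ∧
    ∀ N : Subgroup G, N.Normal → IsOpen (N : Set G) → ∃ k : ℕ, N.index = p ^ k

/-- A valuation on a (topological) group `G`: a continuous function `W : G → ℝ`
with `0 ≤ W g < 1`, `W g = 0 ↔ g = 1`, `W (f*g) ≤ max (W f) (W g)`,
`W [f,g] ≤ W f * W g` and `W (g^p) ≤ (W g)^p`. -/
structure GroupValuation (p : ℕ) (G : Type*) [Group G] [TopologicalSpace G] where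
  toFun : G → ℝ
  continuous_toFun : Continuous toFun
  nonneg : ∀ g, 0 ≤ toFun g
  lt_one : ∀ g, toFun g < 1
  eq_zero_iff : ∀ g, toFun g = 0 ↔ g = 1
  mul_le : ∀ f g, toFun (f * g) ≤ max (toFun f) (toFun g)
  commutator_le : ∀ f g, toFun (f⁻¹ * g⁻¹ * f * g) ≤ toFun f * toFun g
  pow_le : ∀ g, toFun (g ^ p) ≤ toFun g ^ p

variable {G : Type*} [Group G] [TopologicalSpace G]

/-- `G_α = {g : W g ≤ α}`, as a subgroup (it is one, for a valuation `W`). -/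
def levelLE (W : G → ℝ) (α : ℝ) : Subgroup G := Subgroup.closure {g | W g ≤ α}

/-- `G_{<α} = {g : W g < α}`, as a subgroup (it is one, for a valuation `W`). -/
def levelLT (W : G → ℝ) (α : ℝ) : Subgroup G := Subgroup.closure {g | W g < α}

/-- `c_α(H) = log_p [H_α : H_{<α}]`, where `H_α = H ⊓ G_α`, `H_{<α} = H ⊓ G_{<α}`. -/
noncomputable def cval (p : ℕ) (W : G → ℝ) (H : Subgroup G) (α : ℝ) : ℕ :=
  Nat.log p ((levelLT W α ⊓ H).relIndex (levelLE W α ⊓ H))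

/-- The `W`-index `[G:H]_W = ∏_{α ∈ (0,1)} ((1-α^p)/(1-α))^(c_α(G) - c_α(H))`,
as an extended nonnegative real. -/
noncomputable def WIndex (p : ℕ) (W : G → ℝ) (H : Subgroup G) : ℝ≥0∞ :=
  ∏' α : Set.Ioo (0 : ℝ) 1,
    (ENNReal.ofReal ((1 - (α : ℝ) ^ p) / (1 - (α : ℝ)))) ^
      (cval p W ⊤ (α : ℝ) - cval p W H (α : ℝ))

/-- The Frattini-type subgroup `Φ(K)`: the topological closure of the subgroup
generated by all commutators and all `p`-th powers of elements of `K`. -/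
def FrattiniClosure (p : ℕ) [IsTopologicalGroup G] (K : Subgroup G) : Subgroup G :=
  (Subgroup.closure {x | (∃ a ∈ K, ∃ b ∈ K, x = a⁻¹ * b⁻¹ * a * b) ∨
      ∃ a ∈ K, x = a ^ p}).topologicalClosure

/-- The `W`-rank `rk_W(K) = Σ_{α ∈ (0,1)} α · log_p [K_α·Φ(K) : K_{<α}·Φ(K)]`,
as an extended nonnegative real. -/
noncomputable def WRank (p : ℕ) [IsTopologicalGroup G] (W : G → ℝ) (K : Subgroup G) : ℝ≥0∞ :=
  ∑' α : Set.Ioo (0 : ℝ) 1,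
    ENNReal.ofReal (α : ℝ) *
      (Nat.log p (((levelLT W (α : ℝ) ⊓ K) ⊔ FrattiniClosure p K).relIndex
        ((levelLE W (α : ℝ) ⊓ K) ⊔ FrattiniClosure p K)) : ℝ≥0∞)

section Aux

variable {G : Type*} [Group G] [TopologicalSpace G]

theorem levelLT_le_levelLE_aux (W : G → ℝ) (α : ℝ) : levelLT W α ≤ levelLE W α :=
  Subgroup.closure_mono fun x (h : W x < α) => (le_of_lt h : W x ≤ α)

theorem levelLT_normal_aux {p : ℕ} (W : GroupValuation p G) (α : ℝ) :
    (levelLT W.toFun α).Normal := by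
  have key : ∀ f g : G, W.toFun f < α → W.toFun (g⁻¹ * f * g) < α := by
    intro f g hf
    have h1 : g⁻¹ * f * g = f * (f⁻¹ * g⁻¹ * f * g) := by group
    rw [h1]
    refine lt_of_le_of_lt (W.mul_le _ _) (max_lt hf ?_)
    refine lt_of_le_of_lt (W.commutator_le f g) (lt_of_le_of_lt ?_ hf)
    exact mul_le_of_le_one_right (W.nonneg f) (W.lt_one g).le
  constructor
  intro n hn g
  unfold levelLT at hn ⊢
  induction hn using Subgroup.closure_induction with
  | mem x hx =>
    apply Subgroup.subset_closure
    have := key x g⁻¹ hx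
    simpa using this
  | one => simp
  | mul x y _ _ hx hy =>
    have : g * (x * y) * g⁻¹ = (g * x * g⁻¹) * (g * y * g⁻¹) := by group
    rw [this]; exact mul_mem hx hy
  | inv x _ hx =>
    have : g * x⁻¹ * g⁻¹ = (g * x * g⁻¹)⁻¹ := by group
    rw [this]; exact inv_mem hx

theorem levelLT_isOpen_aux [IsTopologicalGroup G] {p : ℕ} (W : GroupValuation p G)
    {α : ℝ} (hα : 0 < α) : IsOpen (levelLT W.toFun α : Set G) := by
  apply Subgroup.isOpen_of_mem_nhds (g := 1)
  have h1 : IsOpen {g | W.toFun g < α} := isOpen_lt W.continuous_toFun continuous_const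
  have h2 : (1 : G) ∈ {g | W.toFun g < α} := by
    have : W.toFun 1 = 0 := (W.eq_zero_iff 1).2 rfl
    simpa [this] using hα
  exact Filter.mem_of_superset (h1.mem_nhds h2) Subgroup.subset_closure

theorem levelLT_index_aux [IsTopologicalGroup G] [CompactSpace G] {p : ℕ}
    (W : GroupValuation p G) {α : ℝ} (hα : 0 < α) : (levelLT W.toFun α).index ≠ 0 := by
  haveI := Subgroup.quotient_finite_of_isOpen _ (levelLT_isOpen_aux W hα)
  exact Subgroup.index_ne_zero_of_finite

theorem cval_eq_aux (p : ℕ) (W : G → ℝ) (H : Subgroup G) (α : ℝ) :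
    cval p W H α = Nat.log p ((levelLT W α).relIndex (levelLE W α ⊓ H)) := by
  unfold cval
  congr 1
  rw [← Subgroup.inf_relIndex_right, ← Subgroup.inf_relIndex_right (levelLT W α)]
  congr 1
  have := levelLT_le_levelLE_aux W α
  ext x
  simp only [Subgroup.mem_inf]
  tauto

theorem cval_mono_aux [IsTopologicalGroup G] [CompactSpace G] {p : ℕ}
    (W : GroupValuation p G) {α : ℝ} (hα : 0 < α) {H K : Subgroup G} (h : H ≤ K) :
    cval p W.toFun H α ≤ cval p W.toFun K α := by
  rw [cval_eq_aux, cval_eq_aux]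
  apply Nat.log_mono_right
  apply Subgroup.relIndex_le_of_le_right (inf_le_inf_left _ h)
  exact fun h0 => levelLT_index_aux W hα (by
    have := levelLT_normal_aux W α
    have := Subgroup.relIndex_dvd_index_of_normal (levelLT W.toFun α) (levelLE W.toFun α ⊓ K)
    rw [h0] at this
    exact Nat.eq_zero_of_zero_dvd this)

theorem cval_sup_aux {p : ℕ} (W : GroupValuation p G) (α : ℝ) (H : Subgroup G) :
    cval p W.toFun (H ⊔ levelLT W.toFun α) α = cval p W.toFun H α := by
  haveI := levelLT_normal_aux W α
  have hle := levelLT_le_levelLE_aux W.toFun α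
  rw [cval_eq_aux, cval_eq_aux]
  have : levelLE W.toFun α ⊓ (H ⊔ levelLT W.toFun α) =
      (levelLE W.toFun α ⊓ H) ⊔ levelLT W.toFun α := by
    apply le_antisymm
    · rintro x ⟨hx1, hx2⟩
      obtain ⟨h, hh, m, hm, rfl⟩ := Subgroup.mem_sup_of_normal_right.1 hx2
      refine Subgroup.mul_mem_sup ⟨?_, hh⟩ hm
      exact (Subgroup.mul_mem_cancel_right _ (hle hm)).1 hx1
    · exact sup_le (inf_le_inf_left _ le_sup_left) (le_inf hle le_sup_right)
  rw [this, Subgroup.relIndex_sup_right]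

/-- The factor of the W-index. -/
noncomputable def wFactorAux (p : ℕ) (W : G → ℝ) (H : Subgroup G) (α : Set.Ioo (0 : ℝ) 1) :
    ℝ≥0∞ :=
  (ENNReal.ofReal ((1 - (α : ℝ) ^ p) / (1 - (α : ℝ)))) ^
      (cval p W ⊤ (α : ℝ) - cval p W H (α : ℝ))

theorem base_one_le_aux {p : ℕ} (hp : p.Prime) (α : Set.Ioo (0 : ℝ) 1) :
    1 ≤ ENNReal.ofReal ((1 - (α : ℝ) ^ p) / (1 - (α : ℝ))) := by
  obtain ⟨α, h0, h1⟩ := α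
  rw [ENNReal.one_le_ofReal, one_le_div (by simpa using h1)]
  have := pow_le_of_le_one h0.le h1.le hp.ne_zero
  show 1 - α ≤ 1 - α ^ p
  linarith

theorem wIndex_eq_aux {p : ℕ} (hp : p.Prime) (W : G → ℝ) (H : Subgroup G) :
    WIndex p W H = ⨆ s : Finset (Set.Ioo (0 : ℝ) 1), ∏ α ∈ s, wFactorAux p W H α := by
  have h : HasProd (wFactorAux p W H) (⨆ s, ∏ α ∈ s, wFactorAux p W H α) := by
    unfold HasProd
    apply tendsto_atTop_iSup
    intro s t hst
    exact Finset.prod_le_prod_of_subset_of_one_le' hst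
      fun α _ _ => one_le_pow₀ (base_one_le_aux hp α)
  exact h.tprod_eq

theorem wIndex_anti_aux [IsTopologicalGroup G] [CompactSpace G] {p : ℕ} (hp : p.Prime)
    (W : GroupValuation p G) {H K : Subgroup G} (h : H ≤ K) :
    WIndex p W.toFun K ≤ WIndex p W.toFun H := by
  rw [wIndex_eq_aux hp, wIndex_eq_aux hp]
  refine iSup_mono fun s => Finset.prod_le_prod' fun α _ => ?_
  exact pow_le_pow_right₀ (base_one_le_aux hp α)
    (Nat.sub_le_sub_left (cval_mono_aux W α.2.1 h) _)

theorem exists_open_aux [IsTopologicalGroup G] [CompactSpace G] {p : ℕ}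
    (W : GroupValuation p G) (H : Subgroup G) (s : Finset (Set.Ioo (0 : ℝ) 1)) :
    ∃ U : Subgroup G, IsOpen (U : Set G) ∧ H ≤ U ∧
      ∀ α ∈ s, cval p W.toFun U (α : ℝ) = cval p W.toFun H (α : ℝ) := by
  classical
  induction s using Finset.induction_on with
  | empty => exact ⟨⊤, isOpen_univ, le_top, by simp⟩
  | insert a s _ ih =>
    obtain ⟨U, hU, hHU, hc⟩ := ih
    have hle : H ≤ U ⊓ (H ⊔ levelLT W.toFun a) := le_inf hHU le_sup_left
    refine ⟨U ⊓ (H ⊔ levelLT W.toFun a), ?_, hle, ?_⟩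
    · exact hU.inter (Subgroup.isOpen_mono le_sup_right (levelLT_isOpen_aux W a.2.1))
    · intro α hα
      refine le_antisymm ?_ (cval_mono_aux W α.2.1 hle)
      rcases Finset.mem_insert.1 hα with rfl | hα
      · exact (cval_mono_aux W α.2.1 inf_le_right).trans (cval_sup_aux W α H).le
      · exact (cval_mono_aux W α.2.1 inf_le_left).trans (hc α hα).le

end Aux

/-- The `W`-index of a closed subgroup is the supremum (equivalently, the limit
along reverse inclusion) of the `W`-indices of the open subgroups containing it,
and the `W`-index is antitone in the open subgroup. -/
theorem wIndex_eq_iSup_open (p : ℕ) (hp : p.Prime)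
    (G : Type*) [Group G] [TopologicalSpace G] [IsTopologicalGroup G]
    (hG : IsProPGroup p G) (W : GroupValuation p G)
    (H : Subgroup G) (hH : IsClosed (H : Set G)) :
    (WIndex p W.toFun H =
      ⨆ (U : Subgroup G) (_ : IsOpen (U : Set G)) (_ : H ≤ U), WIndex p W.toFun U) ∧
    (∀ U U' : Subgroup G, IsOpen (U : Set G) → IsOpen (U' : Set G) →
      H ≤ U' → U' ≤ U → WIndex p W.toFun U ≤ WIndex p W.toFun U') := by
  haveI : CompactSpace G := hG.1
  refine ⟨le_antisymm ?_ ?_, fun U U' _ _ _ h => wIndex_anti_aux hp W h⟩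
  · rw [wIndex_eq_aux hp]
    refine iSup_le fun s => ?_
    obtain ⟨U, hU, hHU, hc⟩ := exists_open_aux W H s
    refine le_trans ?_ (le_iSup_of_le U (le_iSup_of_le hU (le_iSup_of_le hHU le_rfl)))
    rw [wIndex_eq_aux hp]
    refine le_trans (le_of_eq ?_) (le_iSup _ s)
    refine Finset.prod_congr rfl fun α hα => ?_
    unfold wFactorAux
    rw [hc α hα]
  · exact iSup_le fun U => iSup_le fun _ => iSup_le fun h => wIndex_anti_aux hp W h
end

section
/- Let G be a pro-p group and W a valuation on G. Then there exists a subset X of G such that the closed subgroup topologically generated by X is all of G and, for every α ∈ (0,1), the cardinality of {x ∈ X : W(x) = α} equals log_p [G_α·Φ(G) : G_{<α}·Φ(G)]. In particular, if rk_W(G) < ∞, then Σ_{x∈X} W(x) = rk_W(G). -/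
open scoped ENNReal

variable {G : Type*} [Group G] [TopologicalSpace G]

/-- Maximal subgroups of a finite `p`-group contain commutators and `p`-th powers. -/
theorem coatom_contains {p : ℕ} (hp : p.Prime) {Q : Type*} [Group Q] [Finite Q]
    (hQ : IsPGroup p Q) (M : Subgroup Q) (hM : IsCoatom M) :
    (∀ a b : Q, a⁻¹ * b⁻¹ * a * b ∈ M) ∧ ∀ a : Q, a ^ p ∈ M := by
  have : Fact p.Prime := ⟨hp⟩
  have : Group.IsNilpotent Q := hQ.isNilpotent
  have hMn : M.Normal :=
    Subgroup.NormalizerCondition.normal_of_coatom M Group.normalizerCondition_of_isNilpotent hM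
  have hR : IsPGroup p (Q ⧸ M) := hQ.to_quotient M
  have : Group.IsNilpotent (Q ⧸ M) := hR.isNilpotent
  have : Nontrivial (Q ⧸ M) := QuotientGroup.nontrivial_iff.2 hM.1
  have : IsSimpleGroup (Q ⧸ M) := by
    refine ⟨fun K hK => ?_⟩
    have hsurj := QuotientGroup.mk'_surjective M
    have hle : M ≤ K.comap (QuotientGroup.mk' M) := by
      intro x hx
      have : (QuotientGroup.mk' M) x = 1 := (QuotientGroup.eq_one_iff x).2 hx
      simp only [Subgroup.mem_comap, this, one_mem]
    rcases hle.eq_or_lt with h | h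
    · left
      rw [eq_bot_iff]
      intro y hy
      obtain ⟨x, rfl⟩ := hsurj y
      have hx : x ∈ K.comap (QuotientGroup.mk' M) := hy
      rw [← h] at hx
      exact (QuotientGroup.eq_one_iff x).2 hx
    · right
      have h2 := hM.2 _ h
      rw [eq_top_iff]
      intro y _
      obtain ⟨x, rfl⟩ := hsurj y
      have hx : x ∈ K.comap (QuotientGroup.mk' M) := by rw [h2]; trivial
      exact hx
  have hcomm : ∀ a b : Q ⧸ M, a * b = b * a :=
    IsSimpleGroup.comm_iff_isSolvable.2 inferInstance
  let : CommGroup (Q ⧸ M) := { (inferInstance : Group (Q ⧸ M)) with mul_comm := hcomm }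
  have hprime : (Nat.card (Q ⧸ M)).Prime := IsSimpleGroup.prime_card
  obtain ⟨k, hk⟩ := IsPGroup.iff_card.1 hR
  have hcard : Nat.card (Q ⧸ M) = p :=
    (Nat.prime_dvd_prime_iff_eq hprime hp).1 (hprime.dvd_of_dvd_pow (Dvd.intro_left 1 (by rw [one_mul, hk]) : Nat.card (Q ⧸ M) ∣ p ^ k))
  refine ⟨fun a b => ?_, fun a => ?_⟩
  · rw [← QuotientGroup.eq_one_iff]
    have h := hcomm (a : Q ⧸ M) b
    change ((a : Q ⧸ M))⁻¹ * (b : Q ⧸ M)⁻¹ * a * b = 1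
    rw [mul_assoc, h]
    group
  · rw [← QuotientGroup.eq_one_iff]
    change (a : Q ⧸ M) ^ p = 1
    rw [← hcard]
    exact pow_card_eq_one'

/-- A proper closed subgroup of a pro-`p` group is contained in a proper open subgroup
containing the Frattini subgroup. -/
theorem exists_open_maximal {p : ℕ} (hp : p.Prime)
    {G : Type*} [Group G] [TopologicalSpace G] [IsTopologicalGroup G]
    (hG : IsProPGroup p G) (H : Subgroup G) (hH : IsClosed (H : Set G)) (hne : H ≠ ⊤) :
    ∃ M : Subgroup G, IsOpen (M : Set G) ∧ M ≠ ⊤ ∧ H ≤ M ∧ FrattiniClosure p ⊤ ≤ M := by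
  obtain ⟨hc, ht2, htd, hidx⟩ := hG
  obtain ⟨g, hg⟩ : ∃ g, g ∉ H := by
    by_contra! h
    exact hne (eq_top_iff.2 fun x _ => h x)
  have hopen : IsOpen ((fun x : G => x * g) ⁻¹' (H : Set G)ᶜ) :=
    hH.isOpen_compl.preimage (by fun_prop)
  obtain ⟨N, hN⟩ := ProfiniteGrp.exist_openNormalSubgroup_sub_open_nhds_of_one hopen
    (by simpa using hg)
  let N' : Subgroup G := N.toSubgroup
  have hNn : N'.Normal := N.isNormal'
  have hNo : IsOpen (N' : Set G) := N.isOpen'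
  have : Finite (G ⧸ N') := N'.quotient_finite_of_isOpen hNo
  obtain ⟨k, hk⟩ := hidx N' hNn hNo
  have hQ : IsPGroup p (G ⧸ N') := IsPGroup.of_card (n := k) hk
  let π := QuotientGroup.mk' N'
  have hprop : H.map π ≠ ⊤ := by
    intro h
    have : π g ∈ H.map π := by rw [h]; trivial
    obtain ⟨x, hx, hxg⟩ := this
    have hmem : x * g⁻¹ ∈ N' := by
      rw [← QuotientGroup.eq_one_iff]
      change π (x * g⁻¹) = 1
      rw [map_mul, hxg, map_inv, mul_inv_cancel]
    have := hN hmem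
    simp only [Set.mem_preimage, Set.mem_compl_iff] at this
    apply this
    simpa using hx
  obtain ⟨M, hM, hHM⟩ := (eq_top_or_exists_le_coatom (H.map π)).resolve_left hprop
  obtain ⟨h1, h2⟩ := coatom_contains hp hQ M hM
  have hNM : N' ≤ M.comap π := by
    intro x hx
    have : π x = 1 := (QuotientGroup.eq_one_iff x).2 hx
    simp only [Subgroup.mem_comap, this, one_mem]
  have hMo : IsOpen ((M.comap π : Subgroup G) : Set G) := Subgroup.isOpen_mono hNM hNo
  refine ⟨M.comap π, hMo, ?_, Subgroup.map_le_iff_le_comap.1 hHM, ?_⟩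
  · intro h
    apply hM.1
    rw [eq_top_iff]
    intro y _
    obtain ⟨x, rfl⟩ := QuotientGroup.mk'_surjective N' y
    have : x ∈ M.comap π := by rw [h]; trivial
    exact this
  · refine Subgroup.topologicalClosure_minimal _ ?_ (Subgroup.isClosed_of_isOpen _ hMo)
    rw [Subgroup.closure_le]
    rintro x (⟨a, -, b, -, rfl⟩ | ⟨a, -, rfl⟩)
    · simpa using h1 (π a) (π b)
    · simpa using h2 (π a)

/-- Choosing a basis inside a generating set of `A` modulo `B`. -/
theorem exists_basis_lift {p : ℕ} (hp : p.Prime) {G : Type*} [Group G] (S : Set G) :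
    ∀ (n : ℕ) (B : Subgroup G), (∀ a b : G, a⁻¹ * b⁻¹ * a * b ∈ B) → (∀ a : G, a ^ p ∈ B) →
      B.relIndex (B ⊔ Subgroup.closure S) = n → n ≠ 0 →
      ∃ X : Set G, X.Finite ∧ X ⊆ S ∧ (∀ x ∈ X, x ∉ B) ∧ Nat.card X = Nat.log p n ∧
        S ⊆ (B ⊔ Subgroup.closure X : Subgroup G) := by
  intro n
  induction n using Nat.strong_induction_on with
  | _ n ih =>
  intro B hcom hpow hn hn0
  by_cases hS : S ⊆ B
  · refine ⟨∅, Set.finite_empty, Set.empty_subset _, by simp, ?_, by simpa using hS⟩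
    have : B ⊔ Subgroup.closure S = B := sup_eq_left.2 ((Subgroup.closure_le _).2 hS)
    rw [this, Subgroup.relIndex_self] at hn
    simp [← hn]
  · obtain ⟨s, hsS, hsB⟩ := Set.not_subset.1 hS
    have hBn : B.Normal := by
      refine ⟨fun n hn g => ?_⟩
      have h5 := hcom n⁻¹ g⁻¹
      have h6 : g * n * g⁻¹ = ((n⁻¹)⁻¹ * (g⁻¹)⁻¹ * n⁻¹ * g⁻¹)⁻¹ * n := by group
      rw [h6]
      exact B.mul_mem (B.inv_mem h5) hn
    set B' := B ⊔ Subgroup.zpowers s with hB'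
    have hsB' : s ∈ B' := le_sup_right (a := B) (Subgroup.mem_zpowers s)
    have hidx : B.relIndex B' = p := by
      have : Fact p.Prime := ⟨hp⟩
      rw [hB', Subgroup.relIndex_sup_left]
      have := Subgroup.relIndex_ker (Subgroup.zpowers s) (QuotientGroup.mk' B)
      rw [QuotientGroup.ker_mk', MonoidHom.map_zpowers, Nat.card_zpowers] at this
      rw [this]
      apply orderOf_eq_prime
      · rw [← map_pow]
        exact (QuotientGroup.eq_one_iff _).2 (hpow s)
      · intro h
        exact hsB ((QuotientGroup.eq_one_iff _).1 h)
    have hsup : B' ⊔ Subgroup.closure S = B ⊔ Subgroup.closure S := by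
      rw [hB', sup_assoc]
      congr 1
      refine sup_eq_right.2 ?_
      rw [Subgroup.zpowers_le]
      exact Subgroup.subset_closure hsS
    have hmul : p * B'.relIndex (B' ⊔ Subgroup.closure S) = n := by
      have := Subgroup.relIndex_mul_relIndex B B' (B' ⊔ Subgroup.closure S) le_sup_left le_sup_left
      rw [hidx] at this
      rw [this, hsup, hn]
    set m := B'.relIndex (B' ⊔ Subgroup.closure S) with hm
    have hm0 : m ≠ 0 := by rintro h; rw [h] at hmul; simp at hmul; exact hn0 hmul.symm
    have hlt : m < n := by
      rw [← hmul]
      have := hp.two_le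
      have := Nat.pos_of_ne_zero hm0
      nlinarith
    obtain ⟨X, hXf, hXS, hXB, hXc, hSX⟩ := ih m hlt B' (fun a b => le_sup_left (a := B) (hcom a b))
      (fun a => le_sup_left (a := B) (hpow a)) hm.symm hm0
    have hsX : s ∉ X := fun h => hXB s h hsB'
    refine ⟨insert s X, hXf.insert s, Set.insert_subset hsS hXS, ?_, ?_, ?_⟩
    · rintro x (rfl | hx)
      · exact hsB
      · exact fun h => hXB x hx (le_sup_left (a := B) h)
    · rw [Nat.card_coe_set_eq, Set.ncard_insert_of_notMem hsX hXf, ← Nat.card_coe_set_eq, hXc,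
        ← hmul, mul_comm, Nat.log_mul_base hp.one_lt hm0]
    · refine hSX.trans ?_
      have : B' ⊔ Subgroup.closure X ≤ B ⊔ Subgroup.closure (insert s X) := by
        refine sup_le (sup_le le_sup_left ?_) ?_
        · rw [Subgroup.zpowers_le]
          exact le_sup_right (a := B) (Subgroup.subset_closure (Set.mem_insert _ _))
        · exact le_trans (Subgroup.closure_mono (Set.subset_insert _ _)) le_sup_right
      exact this

/-- Existence of a `W`-optimal generating set: there is a topological generating
set `X` of `G` with exactly `log_p [G_α·Φ(G) : G_{<α}·Φ(G)]` elements of weight `α`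
for each `α ∈ (0,1)`; in particular if `rk_W(G) < ∞` then `Σ_{x ∈ X} W(x) = rk_W(G)`. -/
theorem exists_W_optimal_generating_set (p : ℕ) (hp : p.Prime)
    (G : Type*) [Group G] [TopologicalSpace G] [IsTopologicalGroup G]
    (hG : IsProPGroup p G) (W : GroupValuation p G) :
    ∃ X : Set G, (Subgroup.closure X).topologicalClosure = ⊤ ∧
      (∀ α : ℝ, α ∈ Set.Ioo (0 : ℝ) 1 →
        {x ∈ X | W.toFun x = α}.Finite ∧
        Nat.card {x ∈ X | W.toFun x = α} =
          Nat.log p ((levelLT W.toFun α ⊔ FrattiniClosure p (⊤ : Subgroup G)).relIndex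
            (levelLE W.toFun α ⊔ FrattiniClosure p (⊤ : Subgroup G)))) ∧
      (WRank p W.toFun (⊤ : Subgroup G) ≠ ⊤ →
        ∑' x : X, ENNReal.ofReal (W.toFun x) = WRank p W.toFun (⊤ : Subgroup G)) := by
  classical
  have hG' := hG
  obtain ⟨hc, ht2, htd, hidx⟩ := hG'
  set Φ := FrattiniClosure p (⊤ : Subgroup G) with hΦ
  have hΦle : Subgroup.closure {x : G | (∃ a ∈ (⊤ : Subgroup G), ∃ b ∈ (⊤ : Subgroup G),
      x = a⁻¹ * b⁻¹ * a * b) ∨ ∃ a ∈ (⊤ : Subgroup G), x = a ^ p} ≤ Φ :=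
    Subgroup.le_topologicalClosure _
  have hcom : ∀ a b : G, a⁻¹ * b⁻¹ * a * b ∈ Φ := fun a b =>
    hΦle (Subgroup.subset_closure (Or.inl ⟨a, trivial, b, trivial, rfl⟩))
  have hpow : ∀ a : G, a ^ p ∈ Φ := fun a =>
    hΦle (Subgroup.subset_closure (Or.inr ⟨a, trivial, rfl⟩))
  have key : ∀ α : Set.Ioo (0 : ℝ) 1, ∃ X : Set G, X.Finite ∧ (∀ x ∈ X, W.toFun x = α) ∧
      Nat.card X = Nat.log p ((levelLT W.toFun α ⊔ Φ).relIndex (levelLE W.toFun α ⊔ Φ)) ∧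
      {g | W.toFun g ≤ α} ⊆ (levelLT W.toFun α ⊔ Φ ⊔ Subgroup.closure X : Subgroup G) := by
    intro α
    have hle : levelLT W.toFun α ≤ levelLE W.toFun α :=
      Subgroup.closure_mono fun x (hx : W.toFun x < α) => hx.le
    have hsup : levelLT W.toFun α ⊔ Φ ⊔ Subgroup.closure {g | W.toFun g ≤ α} =
        levelLE W.toFun α ⊔ Φ := by
      change levelLT W.toFun α ⊔ Φ ⊔ levelLE W.toFun α = _
      rw [sup_right_comm, sup_eq_right.2 hle]
    have hopen : IsOpen ((levelLT W.toFun α ⊔ Φ : Subgroup G) : Set G) := by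
      refine Subgroup.isOpen_mono (le_sup_left (a := levelLT W.toFun α)) ?_
      refine Subgroup.isOpen_of_mem_nhds _ (g := 1) ?_
      refine Filter.mem_of_superset ?_ Subgroup.subset_closure
      refine (isOpen_lt W.continuous_toFun continuous_const).mem_nhds ?_
      change W.toFun 1 < α
      rw [(W.eq_zero_iff 1).2 rfl]
      exact α.2.1
    have : Finite (G ⧸ (levelLT W.toFun α ⊔ Φ)) := Subgroup.quotient_finite_of_isOpen _ hopen
    have : (levelLT W.toFun α ⊔ Φ).FiniteIndex := Subgroup.finiteIndex_of_finite_quotient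
    obtain ⟨X, h1, h2, h3, h4, h5⟩ := exists_basis_lift hp {g | W.toFun g ≤ α} _
      (levelLT W.toFun α ⊔ Φ) (fun a b => le_sup_right (a := levelLT W.toFun α) (hcom a b))
      (fun a => le_sup_right (a := levelLT W.toFun α) (hpow a)) rfl
      (fun h => Subgroup.FiniteIndex.index_ne_zero (Subgroup.index_eq_zero_of_relIndex_eq_zero h))
    refine ⟨X, h1, fun x hx => le_antisymm (h2 hx) ?_, by rw [h4, hsup], h5⟩
    by_contra! hlt
    exact h3 x hx (le_sup_left (a := levelLT W.toFun α) (Subgroup.subset_closure hlt))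
  choose X hXf hXW hXc hXg using key
  have hfib : ∀ α : Set.Ioo (0 : ℝ) 1, {x ∈ ⋃ β, X β | W.toFun x = α} = X α := by
    intro α
    ext x
    constructor
    · rintro ⟨hx, hxα⟩
      obtain ⟨β, hβ⟩ := Set.mem_iUnion.1 hx
      have : β = α := Subtype.ext ((hXW β x hβ).symm.trans hxα)
      exact this ▸ hβ
    · exact fun hx => ⟨Set.mem_iUnion.2 ⟨α, hx⟩, hXW α x hx⟩
  refine ⟨⋃ α, X α, ?_, ?_, ?_⟩
  · by_contra hne
    obtain ⟨M, hMo, hMne, hHM, hΦM⟩ := exists_open_maximal hp hG _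
      (Subgroup.isClosed_topologicalClosure _) hne
    have hXM : ∀ α, X α ⊆ M := fun α x hx => hHM (Subgroup.le_topologicalClosure _
      (Subgroup.subset_closure (Set.mem_iUnion.2 ⟨α, hx⟩)))
    have hcompact : IsCompact ((M : Set G)ᶜ) := hMo.isClosed_compl.isCompact
    have hnonempty : ((M : Set G)ᶜ).Nonempty := by
      by_contra! h
      exact hMne (eq_top_iff.2 fun x _ => by
        have : x ∉ (M : Set G)ᶜ := by rw [h]; simp
        simpa using this)
    obtain ⟨g, hgM, hmin⟩ := hcompact.exists_isMinOn hnonempty W.continuous_toFun.continuousOn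
    have hpos : 0 < W.toFun g := by
      refine lt_of_le_of_ne (W.nonneg g) fun h => hgM ?_
      rw [(W.eq_zero_iff g).1 h.symm]
      exact one_mem M
    let α : Set.Ioo (0 : ℝ) 1 := ⟨W.toFun g, hpos, W.lt_one g⟩
    have hle : levelLT W.toFun α ⊔ Φ ⊔ Subgroup.closure (X α) ≤ M := by
      refine sup_le (sup_le ?_ hΦM) ((Subgroup.closure_le _).2 (hXM α))
      refine (Subgroup.closure_le _).2 fun x (hx : W.toFun x < W.toFun g) => ?_
      by_contra hxM
      exact absurd (hmin hxM) (not_le.2 hx)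
    exact hgM (hle (hXg α (le_refl (W.toFun g))))
  · intro α hα
    have := hfib ⟨α, hα⟩
    simp only at this
    rw [this]
    exact ⟨hXf _, hXc _⟩
  · intro _
    let f : (⋃ α, X α : Set G) → Set.Ioo (0 : ℝ) 1 := fun x => ⟨W.toFun x, by
      obtain ⟨β, hβ⟩ := Set.mem_iUnion.1 x.2
      rw [hXW β x hβ]
      exact β.2⟩
    unfold WRank
    rw [← (Equiv.sigmaFiberEquiv f).tsum_eq, ENNReal.tsum_sigma']
    refine tsum_congr fun α => ?_
    rw [inf_top_eq, inf_top_eq, ← hΦ, ← hXc α]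
    have hconst : ∀ x : {x // f x = α}, ENNReal.ofReal (W.toFun
        (Equiv.sigmaFiberEquiv f ⟨α, x⟩ : (⋃ α, X α : Set G))) = ENNReal.ofReal α := by
      rintro ⟨x, hx⟩
      have : W.toFun x = α := congrArg Subtype.val hx
      simp [this]
    rw [tsum_congr hconst]
    let e : {x // f x = α} ≃ X α :=
      { toFun := fun x => ⟨x.1, by
          rw [← hfib α]
          exact ⟨x.1.2, congrArg Subtype.val x.2⟩⟩
        invFun := fun x => ⟨⟨x.1, Set.mem_iUnion.2 ⟨α, x.2⟩⟩, Subtype.ext (hXW α x.1 x.2)⟩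
        left_inv := fun x => rfl
        right_inv := fun x => rfl }
    have : Finite (X α) := hXf α
    have : Fintype (X α) := Fintype.ofFinite _
    rw [← e.symm.tsum_eq, tsum_fintype]
    simp [mul_comm]
end

section
/- Let G be a pro-p group and W a valuation on G, and let Y be any subset of G such that the closed subgroup topologically generated by Y is all of G. Then for every α ∈ (0,1), the number of elements y ∈ Y with W(y) ≥ α is at least Σ_{β ∈ [α,1)} log_p [G_β·Φ(G) : G_{<β}·Φ(G)] (equivalently, at least log_p [G : Φ(G)·G_{<α}]). In particular, Σ_{y∈Y} W(y) ≥ rk_W(G). -/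
open scoped ENNReal

variable {G : Type*} [Group G] [TopologicalSpace G]

/-- Discrete layer-cake comparison. -/
lemma layer_aux {ι κ : Type*} (a : ι → ℝ) (ha : ∀ i, 0 ≤ a i) (c : ι → ℝ≥0∞)
    (w : κ → ℝ) (hw : ∀ k, 0 ≤ w k)
    (h : ∀ t : ℝ, 0 < t → ∑' i : {i | t ≤ a i}, c i ≤ (({k | t ≤ w k}.encard : ℕ∞) : ℝ≥0∞)) :
    ∑' i, ENNReal.ofReal (a i) * c i ≤ ∑' k, ENNReal.ofReal (w k) := by
  let : MeasurableSpace ι := ⊤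
  let : MeasurableSpace κ := ⊤
  have hm : ∀ f : ι → ℝ≥0∞, Measurable f := fun f => measurable_from_top
  have h1 := MeasureTheory.lintegral_eq_lintegral_meas_le
    (MeasureTheory.Measure.count.withDensity c) (f := a)
    (Filter.Eventually.of_forall ha) (measurable_from_top.aemeasurable)
  have h2 := MeasureTheory.lintegral_eq_lintegral_meas_le
    (MeasureTheory.Measure.count : MeasureTheory.Measure κ) (f := w)
    (Filter.Eventually.of_forall hw) (measurable_from_top.aemeasurable)
  rw [MeasureTheory.lintegral_withDensity_eq_lintegral_mul _ (hm c) (hm _),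
    MeasureTheory.lintegral_count] at h1
  rw [MeasureTheory.lintegral_count] at h2
  rw [h2]
  calc ∑' i, ENNReal.ofReal (a i) * c i
      = ∑' i, (c * fun ω => ENNReal.ofReal (a ω)) i :=
        tsum_congr fun i => by simp [mul_comm]
    _ = _ := h1
    _ ≤ _ := by
        refine MeasureTheory.setLIntegral_mono' measurableSet_Ioi fun t ht => ?_
        have hs : MeasurableSet {i | t ≤ a i} := MeasurableSpace.measurableSet_top
        have hs' : MeasurableSet {k | t ≤ w k} := MeasurableSpace.measurableSet_top
        rw [MeasureTheory.withDensity_apply _ hs,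
          ← MeasureTheory.lintegral_indicator hs, MeasureTheory.lintegral_count,
          MeasureTheory.Measure.count_apply hs', ← tsum_subtype]
        exact h t ht

lemma level_aux1 {G : Type*} [Group G] (W : G → ℝ) (a : ℝ) : levelLT W a ≤ levelLE W a := by
  unfold levelLT levelLE
  apply Subgroup.closure_mono
  intro g hg
  exact le_of_lt (show W g < a from hg)

lemma level_aux2 {G : Type*} [Group G] (W : G → ℝ) {a b : ℝ} (h : a < b) :
    levelLE W a ≤ levelLT W b := by
  unfold levelLT levelLE
  apply Subgroup.closure_mono
  intro g hg
  exact lt_of_le_of_lt hg h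

lemma level_aux3 {G : Type*} [Group G] (W : G → ℝ) {a b : ℝ} (h : a ≤ b) :
    levelLT W a ≤ levelLT W b := by
  unfold levelLT
  apply Subgroup.closure_mono
  intro g hg
  exact lt_of_lt_of_le hg h

lemma log_add_le {p : ℕ} (hp : 1 < p) {a b : ℕ} (ha : a ≠ 0) (hb : b ≠ 0) :
    Nat.log p a + Nat.log p b ≤ Nat.log p (a * b) := by
  apply Nat.le_log_of_pow_le hp
  rw [pow_add]
  exact Nat.mul_le_mul (Nat.pow_log_le_self p ha) (Nat.pow_log_le_self p hb)

lemma chain_aux {p : ℕ} (hp : 1 < p) {G : Type*} [Group G] (W : G → ℝ) (Φ : Subgroup G)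
    (S : Finset ℝ) : ∀ H : Subgroup G, H.index ≠ 0 → (∀ β ∈ S, H ≤ levelLT W β ⊔ Φ) →
    ∑ β ∈ S, Nat.log p ((levelLT W β ⊔ Φ).relIndex (levelLE W β ⊔ Φ)) ≤ Nat.log p H.index := by
  induction S using Finset.induction_on_min with
  | empty => simp
  | insert a S hS ih =>
    intro H hH hle
    rw [Finset.sum_insert (fun h => lt_irrefl _ (hS a h))]
    have hHa := hle a (Finset.mem_insert_self _ _)
    have hNM : levelLT W a ⊔ Φ ≤ levelLE W a ⊔ Φ :=
      sup_le_sup_right (level_aux1 W a) _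
    have hdvd := Subgroup.index_dvd_of_le hHa
    have hN : (levelLT W a ⊔ Φ).index ≠ 0 := fun h => hH (by
      rw [h] at hdvd; exact Nat.eq_zero_of_zero_dvd hdvd)
    have hmul := Subgroup.relIndex_mul_index hNM
    have h12 : (levelLT W a ⊔ Φ).relIndex (levelLE W a ⊔ Φ) ≠ 0 ∧
        (levelLE W a ⊔ Φ).index ≠ 0 := by
      rw [← hmul] at hN; exact mul_ne_zero_iff.1 hN
    have := ih (levelLE W a ⊔ Φ) h12.2 (fun β hβ =>
      sup_le_sup_right (level_aux2 W (hS β hβ)) _)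
    calc _ ≤ _ := Nat.add_le_add_left this _
      _ ≤ _ := log_add_le hp h12.1 h12.2
      _ = Nat.log p (levelLT W a ⊔ Φ).index := by rw [hmul]
      _ ≤ _ := Nat.log_mono_right (Nat.le_of_dvd (Nat.pos_of_ne_zero hH) hdvd)

lemma gen_aux {p : ℕ} (hp : 1 < p) {G : Type*} [Group G] (N : Subgroup G)
    (hc : ∀ a b : G, a⁻¹ * b⁻¹ * a * b ∈ N) (hpow : ∀ a : G, a ^ p ∈ N)
    (F : Finset G) (hF : N ⊔ Subgroup.closure (F : Set G) = ⊤) :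
    Nat.log p N.index ≤ F.card := by
  classical
  have hn : N.Normal := ⟨fun n hn g => by
    have := hc n⁻¹ g⁻¹
    have h2 := N.mul_mem (N.inv_mem hn) this
    have h3 := N.mul_mem (N.mul_mem hn h2) hn
    have h4 := N.mul_mem this hn
    have := hc g⁻¹ n⁻¹
    have h5 := N.mul_mem this hn
    simpa [mul_assoc] using h5⟩
  let : CommGroup (G ⧸ N) := { (inferInstance : Group (G ⧸ N)) with
    mul_comm := by
      intro x y
      induction x using QuotientGroup.induction_on with | _ a
      induction y using QuotientGroup.induction_on with | _ b
      rw [← QuotientGroup.mk_mul, ← QuotientGroup.mk_mul, QuotientGroup.eq]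
      simpa [mul_assoc] using hc b a }
  have hcl : Subgroup.closure ((F.image (QuotientGroup.mk' N) : Finset (G ⧸ N)) : Set (G ⧸ N)) = ⊤ := by
    have := congrArg (Subgroup.map (QuotientGroup.mk' N)) hF
    rw [Subgroup.map_sup, QuotientGroup.map_mk'_self, bot_sup_eq, MonoidHom.map_closure,
      Subgroup.map_top_of_surjective _ (QuotientGroup.mk'_surjective N)] at this
    rw [Finset.coe_image]; exact this
  have : Group.FG (G ⧸ N) := ⟨⟨_, hcl⟩⟩
  have h1 : Nat.card (G ⧸ N) ∣ p ^ Group.rank (G ⧸ N) := card_dvd_exponent_pow_rank' _ (by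
      intro x
      induction x using QuotientGroup.induction_on with | _ a
      rw [← QuotientGroup.mk_pow, QuotientGroup.eq_one_iff]
      exact hpow a)
  have h2 := Group.rank_le hcl
  calc Nat.log p N.index ≤ Nat.log p (p ^ Group.rank (G ⧸ N)) :=
        Nat.log_mono_right (Nat.le_of_dvd (by positivity) h1)
    _ = Group.rank (G ⧸ N) := Nat.log_pow hp _
    _ ≤ _ := h2.trans Finset.card_image_le

lemma part_one {p : ℕ} (hp : p.Prime)
    {G : Type*} [Group G] [TopologicalSpace G] [IsTopologicalGroup G]
    (hG : IsProPGroup p G) (W : GroupValuation p G)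
    (Y : Set G) (hY : (Subgroup.closure Y).topologicalClosure = ⊤) (α : ℝ) (hα : 0 < α) :
      ∑' β : Set.Ici α,
        ((Nat.log p ((levelLT W.toFun (β : ℝ) ⊔ FrattiniClosure p (⊤ : Subgroup G)).relIndex
            (levelLE W.toFun (β : ℝ) ⊔ FrattiniClosure p (⊤ : Subgroup G)))) : ℝ≥0∞) ≤
      (({y ∈ Y | α ≤ W.toFun y}.encard : ℕ∞) : ℝ≥0∞) := by
  classical
  have := hG.1
  set Φ := FrattiniClosure p (⊤ : Subgroup G) with hΦ
  have hopen : IsOpen ((levelLT W.toFun α ⊔ Φ : Subgroup G) : Set G) := by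
    apply Subgroup.isOpen_mono (H₁ := levelLT W.toFun α) le_sup_left
    apply Subgroup.isOpen_of_mem_nhds (g := 1)
    refine Filter.mem_of_superset ((isOpen_lt W.continuous_toFun continuous_const).mem_nhds
      (?_ : W.toFun 1 < α)) Subgroup.subset_closure
    rw [(W.eq_zero_iff 1).2 rfl]; exact hα
  have hcl : ∀ x, ((∃ a ∈ (⊤ : Subgroup G), ∃ b ∈ (⊤ : Subgroup G), x = a⁻¹ * b⁻¹ * a * b) ∨
      ∃ a ∈ (⊤ : Subgroup G), x = a ^ p) → x ∈ levelLT W.toFun α ⊔ Φ := fun x hx =>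
    (le_sup_right : Φ ≤ _) (Subgroup.le_topologicalClosure _ (Subgroup.subset_closure hx))
  have hidx : (levelLT W.toFun α ⊔ Φ).index ≠ 0 := by
    have := Subgroup.quotient_finite_of_isOpen _ hopen
    exact Subgroup.index_ne_zero_of_finite
  rcases Set.finite_or_infinite {y ∈ Y | α ≤ W.toFun y} with hfin | hinf
  swap
  · rw [hinf.encard_eq]; simp
  have hgen : (levelLT W.toFun α ⊔ Φ) ⊔ Subgroup.closure (hfin.toFinset : Set G) = ⊤ := by
    rw [eq_top_iff, ← hY]
    apply Subgroup.topologicalClosure_minimal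
    · rw [Subgroup.closure_le]
      intro y hy
      by_cases h : α ≤ W.toFun y
      · exact (le_sup_right : _ ≤ (levelLT W.toFun α ⊔ Φ) ⊔ _)
          (Subgroup.subset_closure (by simpa using ⟨hy, h⟩))
      · exact (le_sup_left.trans le_sup_left : levelLT W.toFun α ≤ _)
          (Subgroup.subset_closure (not_le.1 h))
    · exact Subgroup.isClosed_of_isOpen _ (Subgroup.isOpen_mono le_sup_left hopen)
  have hlog := gen_aux hp.one_lt _ (fun a b => hcl _ (Or.inl ⟨a, trivial, b, trivial, rfl⟩))
    (fun a => hcl _ (Or.inr ⟨a, trivial, rfl⟩)) hfin.toFinset hgen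
  rw [hfin.encard_eq_coe_toFinset_card, ENNReal.tsum_eq_iSup_sum]
  refine iSup_le fun S => ?_
  have := chain_aux hp.one_lt W.toFun Φ (S.map (Function.Embedding.subtype _)) _ hidx (by
    intro β hβ
    obtain ⟨b, -, rfl⟩ := Finset.mem_map.1 hβ
    exact sup_le_sup_right (level_aux3 W.toFun b.2) _)
  rw [Finset.sum_map] at this
  have h3 := this.trans hlog
  rw [ENat.toENNReal_coe, ← Nat.cast_sum]
  exact_mod_cast h3

/-- Any topological generating set `Y` of `G` has, for each `α ∈ (0,1)`, at least
`Σ_{β ∈ [α,1)} log_p [G_β·Φ(G) : G_{<β}·Φ(G)]` elements of weight `≥ α`; in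
particular `Σ_{y ∈ Y} W(y) ≥ rk_W(G)`. -/
theorem generating_set_weight_lower_bound (p : ℕ) (hp : p.Prime)
    (G : Type*) [Group G] [TopologicalSpace G] [IsTopologicalGroup G]
    (hG : IsProPGroup p G) (W : GroupValuation p G)
    (Y : Set G) (hY : (Subgroup.closure Y).topologicalClosure = ⊤) :
    (∀ α : ℝ, α ∈ Set.Ioo (0 : ℝ) 1 →
      ∑' β : Set.Ico α (1 : ℝ),
        ((Nat.log p ((levelLT W.toFun (β : ℝ) ⊔ FrattiniClosure p (⊤ : Subgroup G)).relIndex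
            (levelLE W.toFun (β : ℝ) ⊔ FrattiniClosure p (⊤ : Subgroup G)))) : ℝ≥0∞) ≤
      (({y ∈ Y | α ≤ W.toFun y}.encard : ℕ∞) : ℝ≥0∞)) ∧
    WRank p W.toFun (⊤ : Subgroup G) ≤ ∑' y : Y, ENNReal.ofReal (W.toFun y) := by
  constructor
  · intro α hα
    refine le_trans ?_ (part_one hp hG W Y hY α hα.1)
    exact ENNReal.tsum_comp_le_tsum_of_injective
      (f := fun b : Set.Ico α (1 : ℝ) => (⟨b, b.2.1⟩ : Set.Ici α))
      (fun x y h => Subtype.ext (congrArg Subtype.val h :))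
      (fun β : Set.Ici α =>
        ((Nat.log p ((levelLT W.toFun (β : ℝ) ⊔ FrattiniClosure p (⊤ : Subgroup G)).relIndex
            (levelLE W.toFun (β : ℝ) ⊔ FrattiniClosure p (⊤ : Subgroup G))) : ℕ) : ℝ≥0∞))
  · unfold WRank
    simp only [inf_top_eq]
    refine layer_aux (fun a : Set.Ioo (0 : ℝ) 1 => (a : ℝ)) (fun i => i.2.1.le) _
      (fun y : Y => W.toFun y) (fun y => W.nonneg y) ?_
    intro t ht
    have h1 : {y ∈ Y | t ≤ W.toFun y}.encard = {k : Y | t ≤ W.toFun k}.encard := by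
      rw [← Subtype.val_injective.encard_image {k : Y | t ≤ W.toFun k}]
      congr 1
      ext y
      simp [and_comm]
    rw [← h1]
    refine le_trans ?_ (part_one hp hG W Y hY t ht)
    exact ENNReal.tsum_comp_le_tsum_of_injective
      (f := fun b : {i : Set.Ioo (0 : ℝ) 1 | t ≤ (i : ℝ)} => (⟨b.1.1, b.2⟩ : Set.Ici t))
      (fun x y h => Subtype.ext (Subtype.ext (congrArg Subtype.val h :)))
      (fun β : Set.Ici t =>
        ((Nat.log p ((levelLT W.toFun (β : ℝ) ⊔ FrattiniClosure p (⊤ : Subgroup G)).relIndex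
            (levelLE W.toFun (β : ℝ) ⊔ FrattiniClosure p (⊤ : Subgroup G))) : ℕ) : ℝ≥0∞))
end

section
/- Let p be a prime and B a topological ring of characteristic p. Let w : B → ℝ be a continuous function such that: w(b) ≥ 0 for all b ∈ B; w(b) = 0 if and only if b = 0; w(1) = 1; w(b + c) ≤ max(w(b), w(c)) for all b, c ∈ B; and w(bc) ≤ w(b)·w(c) for all b, c ∈ B. Let G be a subgroup of the group of units of B such that w(g − 1) < 1 for every g ∈ G (where g is regarded as an element of B), and define W : G → ℝ by W(g) = w(g − 1). Then: W is continuous; 0 ≤ W(g) < 1 for all g ∈ G; W(g) = 0 if and only if g = 1; W(fg) ≤ max(W(f), W(g)) for all f, g ∈ G; W([f,g]) ≤ W(f)·W(g) for all f, g ∈ G, where [f,g] = f⁻¹g⁻¹fg; and W(g^p) ≤ W(g)^p for all g ∈ G. -/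
/-- A ring valuation on a topological ring `B` of characteristic `p` induces a
group valuation `W(g) = w(g - 1)` on any subgroup `G` of the units of `B` on
which `w(g - 1) < 1`. -/
theorem ring_valuation_induces_group_valuation (p : ℕ) (hp : p.Prime)
    (B : Type*) [Ring B] [TopologicalSpace B] [IsTopologicalRing B] [CharP B p]
    (w : B → ℝ) (hw_cont : Continuous w)
    (hw_nonneg : ∀ b, 0 ≤ w b)
    (hw_zero : ∀ b, w b = 0 ↔ b = 0)
    (hw_one : w 1 = 1)
    (hw_add : ∀ b c, w (b + c) ≤ max (w b) (w c))
    (hw_mul : ∀ b c, w (b * c) ≤ w b * w c)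
    (G : Subgroup Bˣ) (hG : ∀ g : G, w (((g : Bˣ) : B) - 1) < 1)
    (W : G → ℝ) (hW : ∀ g : G, W g = w (((g : Bˣ) : B) - 1)) :
    Continuous W ∧
    (∀ g : G, 0 ≤ W g) ∧
    (∀ g : G, W g < 1) ∧
    (∀ g : G, W g = 0 ↔ g = 1) ∧
    (∀ f g : G, W (f * g) ≤ max (W f) (W g)) ∧
    (∀ f g : G, W (f⁻¹ * g⁻¹ * f * g) ≤ W f * W g) ∧
    (∀ g : G, W (g ^ p) ≤ W g ^ p) := by
  have hnat : ∀ n : ℕ, w (n : B) ≤ 1 := by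
    intro n
    induction n with
    | zero => rw [Nat.cast_zero, (hw_zero 0).2 rfl]; exact zero_le_one
    | succ k ih =>
      rw [Nat.cast_succ]
      exact (hw_add _ _).trans (max_le ih hw_one.le)
  have hneg1 : w (-1) ≤ 1 := by
    have h : ((p - 1 : ℕ) : B) = -1 := by
      rw [Nat.cast_sub hp.one_le, CharP.cast_eq_zero, Nat.cast_one, zero_sub]
    rw [← h]; exact hnat _
  have hneg : ∀ b, w (-b) ≤ w b := by
    intro b
    have h := hw_mul (-1) b
    rw [neg_one_mul] at h
    exact h.trans (mul_le_of_le_one_left (hw_nonneg b) hneg1)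
  have hunit : ∀ g : G, w ((g : Bˣ) : B) ≤ 1 := by
    intro g
    have h := hw_add (((g : Bˣ) : B) - 1) 1
    rw [sub_add_cancel] at h
    exact h.trans (max_le (hG g).le hw_one.le)
  have hsmul : ∀ (g : G) (b : B), w (((g : Bˣ) : B) * b) ≤ w b := fun g b =>
    (hw_mul _ _).trans (mul_le_of_le_one_left (hw_nonneg b) (hunit g))
  refine ⟨?_, ?_, ?_, ?_, ?_, ?_, ?_⟩
  · rw [funext hW]
    exact hw_cont.comp
      ((Units.continuous_val.comp continuous_subtype_val).sub continuous_const)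
  · intro g; rw [hW]; exact hw_nonneg _
  · intro g; rw [hW]; exact hG g
  · intro g
    rw [hW, hw_zero, sub_eq_zero, Units.val_eq_one, OneMemClass.coe_eq_one]
  · intro f g
    rw [hW, hW, hW]
    have e : (((f * g : G) : Bˣ) : B) - 1
        = (((f : Bˣ) : B) - 1) + ((f : Bˣ) : B) * (((g : Bˣ) : B) - 1) := by
      push_cast; noncomm_ring
    rw [e]
    exact (hw_add _ _).trans (max_le_max le_rfl (hsmul _ _))
  · intro f g
    rw [hW, hW, hW]
    have e : (((f⁻¹ * g⁻¹ * f * g : G) : Bˣ) : B) - 1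
        = ((f⁻¹ : G) : Bˣ) * (((g⁻¹ : G) : Bˣ) *
          ((((f : Bˣ) : B) - 1) * (((g : Bˣ) : B) - 1)
            + -((((g : Bˣ) : B) - 1) * (((f : Bˣ) : B) - 1)))) := by
      have h1 : (((f : Bˣ) : B) - 1) * (((g : Bˣ) : B) - 1)
            + -((((g : Bˣ) : B) - 1) * (((f : Bˣ) : B) - 1))
          = ((f : Bˣ) : B) * ((g : Bˣ) : B) - ((g : Bˣ) : B) * ((f : Bˣ) : B) := by
        noncomm_ring
      rw [h1]
      simp [mul_sub, mul_assoc]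
    rw [e]
    refine (hsmul _ _).trans ((hsmul _ _).trans ((hw_add _ _).trans (max_le (hw_mul _ _) ?_)))
    refine (hneg _).trans ((hw_mul _ _).trans ?_)
    rw [mul_comm]
  · intro g
    rw [hW, hW]
    have : Fact p.Prime := ⟨hp⟩
    have e : (((g ^ p : G) : Bˣ) : B) - 1 = (((g : Bˣ) : B) - 1) ^ p := by
      rw [sub_pow_char_of_commute p (Commute.one_right ((g : Bˣ) : B))]
      simp
    rw [e]
    have hpow : ∀ (b : B) (n : ℕ), w (b ^ n) ≤ w b ^ n := by
      intro b n
      induction n with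
      | zero => simp [hw_one]
      | succ k ih =>
        rw [pow_succ, pow_succ]
        exact (hw_mul _ _).trans (mul_le_mul_of_nonneg_right ih (hw_nonneg b))
    exact hpow _ _
end

section
/- Let G be a compact Hausdorff topological group and W : G → ℝ a continuous function satisfying W(fg) ≤ max(W(f), W(g)) for all f, g ∈ G. Then W(g⁻¹) = W(g) for every g ∈ G. -/
/-- On a compact Hausdorff topological group, a continuous function satisfying the
ultrametric inequality `W(fg) ≤ max (W f) (W g)` satisfies `W(g⁻¹) = W(g)`. -/
theorem valuation_inv_eq (G : Type*) [Group G] [TopologicalSpace G] [IsTopologicalGroup G]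
    [CompactSpace G] [T2Space G]
    (W : G → ℝ) (hW : Continuous W)
    (hmul : ∀ f g : G, W (f * g) ≤ max (W f) (W g)) :
    ∀ g : G, W g⁻¹ = W g := by
  have hpow : ∀ (g : G) (n : ℕ), W (g ^ (n + 1)) ≤ W g := by
    intro g n
    induction n with
    | zero => simp
    | succ k ih =>
      rw [pow_succ]
      exact (hmul _ _).trans (max_le ih le_rfl)
  have hle : ∀ g : G, W g⁻¹ ≤ W g := by
    intro g
    have hc : MapClusterPt g⁻¹ Filter.atTop (g ^ · : ℕ → G) := by
      simpa using mapClusterPt_self_zpow_atTop_pow g (-1)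
    have hcl : IsClosed {x : G | W x ≤ W g} := isClosed_le hW continuous_const
    by_contra hn
    have hf := hc.frequently (hcl.isOpen_compl.mem_nhds hn)
    obtain ⟨n, hn1, hn2⟩ := (hf.and_eventually (Filter.eventually_ge_atTop 1)).exists
    obtain ⟨k, rfl⟩ := Nat.exists_eq_add_of_le' hn2
    exact hn1 (hpow g k)
  intro g
  refine le_antisymm (hle g) ?_
  simpa using hle g⁻¹
end

section
/- Let G be a compact Hausdorff topological group and W : G → ℝ a continuous function satisfying W(1) = 0 and W(fg) ≤ max(W(f), W(g)) for all f, g ∈ G. Then for every real number α > 0, the set of values {W(g) : g ∈ G, W(g) > α} is finite. -/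
/-- On a compact Hausdorff topological group, a continuous function with `W 1 = 0`
satisfying the ultrametric inequality takes only finitely many values above any
`α > 0`. -/
theorem valuation_values_above_finite (G : Type*) [Group G] [TopologicalSpace G]
    [IsTopologicalGroup G] [CompactSpace G] [T2Space G]
    (W : G → ℝ) (hW : Continuous W) (hone : W 1 = 0)
    (hmul : ∀ f g : G, W (f * g) ≤ max (W f) (W g)) :
    ∀ α : ℝ, 0 < α → {r : ℝ | α < r ∧ ∃ g : G, W g = r}.Finite := by
  intro α hα
  have hK : IsCompact {g : G | α ≤ W g} := (isClosed_le continuous_const hW).isCompact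
  have hnhds : ∀ g ∈ {g : G | α ≤ W g}, {x : G | W x = W g} ∈ nhds g := by
    intro g hg
    have hg' : α ≤ W g := hg
    have h1 : ∀ᶠ x in nhds g, W (g⁻¹ * x) < α := by
      have hc : Continuous fun x : G => W (g⁻¹ * x) := by fun_prop
      exact hc.continuousAt.eventually_lt continuousAt_const (by simpa [hone] using hα)
    have h2 : ∀ᶠ x in nhds g, W (x⁻¹ * g) < α := by
      have hc : Continuous fun x : G => W (x⁻¹ * g) := by fun_prop
      exact hc.continuousAt.eventually_lt continuousAt_const (by simpa [hone] using hα)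
    filter_upwards [h1, h2] with x hx1 hx2
    have e1 := hmul g (g⁻¹ * x)
    have e2 := hmul x (x⁻¹ * g)
    rw [mul_inv_cancel_left] at e1 e2
    show W x = W g
    apply le_antisymm
    · rcases le_max_iff.1 e1 with h | h <;> linarith
    · rcases le_max_iff.1 e2 with h | h <;> linarith
  obtain ⟨t, -, ht⟩ := hK.elim_nhds_subcover (fun g => {x : G | W x = W g}) hnhds
  refine (t.finite_toSet.image W).subset ?_
  rintro r ⟨hr, g, rfl⟩
  obtain ⟨i, hi, hgi⟩ := Set.mem_iUnion₂.1 (ht (show α ≤ W g from hr.le))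
  exact ⟨i, hi, Eq.symm hgi⟩
end

section
/- Let p be a prime, G a compact Hausdorff topological group, and W : G → ℝ a continuous function such that: 0 ≤ W(g) < 1 for all g; W(g) = 0 if and only if g = 1; W(fg) ≤ max(W(f), W(g)) for all f, g; W([f,g]) ≤ W(f)·W(g) for all f, g, where [f,g] = f⁻¹g⁻¹fg; and W(g^p) ≤ W(g)^p for all g. For α ∈ (0,1) set G_α = {g ∈ G : W(g) ≤ α}. Then: (1) each G_α is an open normal subgroup of G of finite index; (2) for every neighborhood U of the identity there exists α ∈ (0,1) with G_α ⊆ U; and (3) the family {G_α : α ∈ (0,1)} contains only countably many distinct subgroups, so G has a countable neighborhood basis at the identity consisting of open normal subgroups. -/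
/-- A valuation on a compact Hausdorff topological group: (1) each level set
`G_α = {g : W g ≤ α}` (for `α ∈ (0,1)`) is an open normal subgroup of finite index;
(2) the `G_α` form a neighborhood basis at the identity; (3) only countably many
distinct `G_α` occur, so there is a countable neighborhood basis at the identity
consisting of open normal subgroups. -/
theorem valuation_level_sets (p : ℕ) (hp : p.Prime)
    (G : Type*) [Group G] [TopologicalSpace G] [IsTopologicalGroup G]
    [CompactSpace G] [T2Space G]
    (W : G → ℝ) (hcont : Continuous W)
    (hnonneg : ∀ g, 0 ≤ W g) (hlt : ∀ g, W g < 1)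
    (hzero : ∀ g, W g = 0 ↔ g = 1)
    (hmul : ∀ f g : G, W (f * g) ≤ max (W f) (W g))
    (hcomm : ∀ f g : G, W (f⁻¹ * g⁻¹ * f * g) ≤ W f * W g)
    (hpow : ∀ g : G, W (g ^ p) ≤ W g ^ p) :
    (∀ α ∈ Set.Ioo (0 : ℝ) 1, ∃ H : Subgroup G,
        (H : Set G) = {g | W g ≤ α} ∧ H.Normal ∧ IsOpen (H : Set G) ∧ H.FiniteIndex) ∧
    (∀ U ∈ nhds (1 : G), ∃ α ∈ Set.Ioo (0 : ℝ) 1, {g | W g ≤ α} ⊆ U) ∧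
    ({S : Set G | ∃ α ∈ Set.Ioo (0 : ℝ) 1, S = {g | W g ≤ α}}.Countable ∧
      ∃ B : ℕ → Subgroup G, (∀ n, (B n).Normal ∧ IsOpen ((B n) : Set G)) ∧
        ∀ U ∈ nhds (1 : G), ∃ n, ((B n) : Set G) ⊆ U) := by
  have h1 : W 1 = 0 := (hzero 1).2 rfl
  have hpw : ∀ (g : G) (n : ℕ), W (g ^ n) ≤ W g := by
    intro g n
    induction n with
    | zero => simpa [h1] using hnonneg g
    | succ k ih =>
      rw [pow_succ]
      exact (hmul _ _).trans (max_le ih le_rfl)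
  have hinv : ∀ (α : ℝ), 0 < α → ∀ g, W g ≤ α → W g⁻¹ ≤ α := by
    intro α hα g hg
    have hV : {h : G | W h⁻¹ < α} ∈ nhds (1 : G) := by
      apply (isOpen_lt (hcont.comp continuous_inv) continuous_const).mem_nhds
      simpa [h1] using hα
    have hc : MapClusterPt (1 : G) Filter.atTop (fun n : ℕ => g ^ n) :=
      mapClusterPt_one_atTop_pow g
    have hf := (hc.frequently hV).and_eventually (Filter.eventually_ge_atTop 1)
    obtain ⟨n, hn, hn1⟩ := hf.exists
    obtain ⟨k, rfl⟩ : ∃ k, n = k + 1 := ⟨n - 1, by omega⟩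
    have e : g⁻¹ = g ^ k * (g ^ (k + 1))⁻¹ := by
      rw [pow_succ']; group
    rw [e]
    exact (hmul _ _).trans (max_le ((hpw g k).trans hg) (le_of_lt hn))
  have key : ∀ α ∈ Set.Ioo (0 : ℝ) 1, ∃ H : Subgroup G,
        (H : Set G) = {g | W g ≤ α} ∧ H.Normal ∧ IsOpen (H : Set G) ∧ H.FiniteIndex := by
    rintro α ⟨hα, -⟩
    let H : Subgroup G :=
      { carrier := {g | W g ≤ α}
        mul_mem' := fun {a b} ha hb => (hmul a b).trans (max_le ha hb)
        one_mem' := by simpa [h1] using hα.le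
        inv_mem' := fun {a} ha => hinv α hα a ha }
    have hop : IsOpen (H : Set G) := by
      apply H.isOpen_of_mem_nhds (g := 1)
      have : {g : G | W g < α} ∈ nhds (1 : G) := by
        apply (isOpen_lt hcont continuous_const).mem_nhds
        simpa [h1] using hα
      exact Filter.mem_of_superset this (fun g (hg : W g < α) => show W g ≤ α from hg.le)
    refine ⟨H, rfl, ⟨?_⟩, hop, ?_⟩
    · intro n hn g
      change W (g * n * g⁻¹) ≤ α
      have hn' : W n ≤ α := hn
      have e : g * n * g⁻¹ = ((g⁻¹)⁻¹ * (n⁻¹)⁻¹ * g⁻¹ * n⁻¹) * n := by group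
      rw [e]
      refine (hmul _ _).trans (max_le ((hcomm _ _).trans ?_) hn')
      have := hinv α hα n hn'
      nlinarith [hnonneg n⁻¹, hlt g⁻¹, hnonneg g⁻¹]
    · have := H.quotient_finite_of_isOpen hop
      exact Subgroup.finiteIndex_of_finite_quotient
  have nb : ∀ U ∈ nhds (1 : G), ∃ α ∈ Set.Ioo (0 : ℝ) 1, {g | W g ≤ α} ⊆ U := by
    intro U hU
    have hK : IsCompact ((interior U)ᶜ) := isOpen_interior.isClosed_compl.isCompact
    rcases Set.eq_empty_or_nonempty ((interior U)ᶜ) with he | hne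
    · refine ⟨1/2, by norm_num, fun g _ => interior_subset ?_⟩
      by_contra hg
      have : g ∈ (interior U)ᶜ := hg
      simp [he] at this
    · obtain ⟨m, hm, hmin⟩ := hK.exists_isMinOn hne hcont.continuousOn
      have hpos : 0 < W m := by
        refine lt_of_le_of_ne (hnonneg m) (fun h => ?_)
        have := (hzero m).1 h.symm
        subst this
        exact hm (mem_interior_iff_mem_nhds.2 hU)
      refine ⟨W m / 2, ⟨by linarith, by linarith [hlt m]⟩, fun g hg => interior_subset ?_⟩
      by_contra hgu
      have h2 : W m ≤ W g := hmin hgu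
      have h3 : W g ≤ W m / 2 := hg
      linarith
  have hα : ∀ n : ℕ, (1 : ℝ) / (n + 2) ∈ Set.Ioo (0 : ℝ) 1 := by
    intro n
    have : (0 : ℝ) ≤ n := n.cast_nonneg
    refine ⟨by positivity, ?_⟩
    rw [div_lt_one (by positivity)]
    linarith
  choose B hB hBn hBo hBf using fun n : ℕ => key _ (hα n)
  have hsmall : ∀ α : ℝ, 0 < α → ∃ n : ℕ, (1 : ℝ) / (n + 2) ≤ α := by
    intro α h
    obtain ⟨n, hn⟩ := exists_nat_one_div_lt h
    refine ⟨n, le_trans ?_ hn.le⟩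
    apply one_div_le_one_div_of_le <;> linarith [(n.cast_nonneg : (0 : ℝ) ≤ n)]
  refine ⟨key, nb, ?_, B, fun n => ⟨hBn n, hBo n⟩, ?_⟩
  · have hc : (⋃ n : ℕ, Set.range
        (fun T : Set (G ⧸ B n) => (QuotientGroup.mk : G → G ⧸ B n) ⁻¹' T)).Countable := by
      apply Set.countable_iUnion
      intro n
      have := hBf n
      have : Finite (G ⧸ B n) := inferInstance
      exact Set.countable_range _
    refine hc.mono ?_
    rintro S ⟨α, ha, rfl⟩
    obtain ⟨n, hn⟩ := hsmall α ha.1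
    refine Set.mem_iUnion.2 ⟨n, QuotientGroup.mk '' {g | W g ≤ α}, ?_⟩
    ext g
    constructor
    · rintro ⟨x, hx, hxg⟩
      have h4 : x⁻¹ * g ∈ (B n : Set G) := QuotientGroup.eq.1 hxg
      rw [hB n] at h4
      have h5 : W (x⁻¹ * g) ≤ α := le_trans h4 hn
      have e : g = x * (x⁻¹ * g) := by group
      change W g ≤ α
      rw [e]
      exact (hmul _ _).trans (max_le hx h5)
    · intro hg
      exact ⟨g, hg, rfl⟩
  · intro U hU
    obtain ⟨α, ha, hs⟩ := nb U hU
    obtain ⟨n, hn⟩ := hsmall α ha.1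
    refine ⟨n, ?_⟩
    rw [hB n]
    exact fun g hg => hs (le_trans hg hn)
end

section
/- Let G be a compact Hausdorff totally disconnected topological group which is first countable, and let W : G → ℝ be a continuous function with 0 ≤ W(g) < 1 for all g, W(1) = 0, and W(fg) ≤ max(W(f), W(g)) for all f, g ∈ G. Let Γ be a dense subgroup of G, let g ∈ G, and let ε > 0. Then there exists a sequence (g_i)_{i≥0} of elements of Γ such that the partial products g_0·g_1⋯g_n converge to g as n → ∞, the series Σ_{i≥1} W(g_i) converges with sum at most ε, and W(g_0) = W(g). -/
/-- Discretization: given a pseudo-valuation `W` on a compact Hausdorff totally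
disconnected first-countable topological group `G`, a dense subgroup `Γ`, an
element `g ∈ G` and `ε > 0`, one can write `g` as a convergent product
`g = g₀ · g₁ · g₂ ⋯` of elements of `Γ` with `Σ_{i ≥ 1} W(gᵢ) ≤ ε` and
`W(g₀) = W(g)`. -/
theorem pseudo_valuation_discretization (G : Type*) [Group G] [TopologicalSpace G]
    [IsTopologicalGroup G] [CompactSpace G] [T2Space G] [TotallyDisconnectedSpace G]
    [FirstCountableTopology G]
    (W : G → ℝ) (hcont : Continuous W)
    (hnonneg : ∀ g, 0 ≤ W g) (hlt : ∀ g, W g < 1) (hone : W 1 = 0)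
    (hmul : ∀ f g : G, W (f * g) ≤ max (W f) (W g))
    (Γ : Subgroup G) (hΓ : Dense (Γ : Set G))
    (g : G) (ε : ℝ) (hε : 0 < ε) :
    ∃ gs : ℕ → G, (∀ i, gs i ∈ Γ) ∧
      Filter.Tendsto (fun n => ((List.range n).map gs).prod) Filter.atTop (nhds g) ∧
      Summable (fun i : ℕ => W (gs (i + 1))) ∧
      (∑' i : ℕ, W (gs (i + 1))) ≤ ε ∧
      W (gs 0) = W g := by
  have key : ∀ U ∈ nhds g, ∀ δ : ℝ, 0 < δ →
      ∃ p ∈ Γ, p ∈ U ∧ W (p⁻¹ * g) < δ ∧ W (g⁻¹ * p) < δ := by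
    intro U hU δ hδ
    have c1 : Continuous fun p : G => W (p⁻¹ * g) := by fun_prop
    have c2 : Continuous fun p : G => W (g⁻¹ * p) := by fun_prop
    have e1 : ∀ᶠ p in nhds g, W (p⁻¹ * g) < δ :=
      c1.continuousAt.eventually_lt continuousAt_const (by simpa [hone] using hδ)
    have e2 : ∀ᶠ p in nhds g, W (g⁻¹ * p) < δ :=
      c2.continuousAt.eventually_lt continuousAt_const (by simpa [hone] using hδ)
    have e := (Filter.eventually_mem_set.mpr hU).and (e1.and e2)
    obtain ⟨p, hp, hpΓ⟩ := mem_closure_iff_nhds.mp (hΓ g) _ e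
    exact ⟨p, hpΓ, hp.1, hp.2.1, hp.2.2⟩
  obtain ⟨U, hU⟩ := (nhds g).exists_antitone_basis
  have hδ : ∀ n : ℕ, 0 < ε / 2 / 2 ^ n := fun n => by positivity
  have h0 : ∃ p ∈ Γ, W (p⁻¹ * g) < ε / 2 / 2 ^ 0 ∧ W p = W g := by
    rcases (hnonneg g).eq_or_lt with h | h
    · refine ⟨1, Γ.one_mem, ?_, by rw [hone, h]⟩
      rw [inv_one, one_mul, ← h]
      exact hδ 0
    · obtain ⟨p, hp, -, h1, h2⟩ := key _ Filter.univ_mem _ (lt_min (hδ 0) h)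
      refine ⟨p, hp, h1.trans_le (min_le_left _ _), le_antisymm ?_ ?_⟩
      · have := hmul g (g⁻¹ * p)
        rw [mul_inv_cancel_left] at this
        exact this.trans (max_le le_rfl (h2.le.trans (min_le_right _ _)))
      · have := hmul p (p⁻¹ * g)
        rw [mul_inv_cancel_left] at this
        rcases le_max_iff.mp this with h' | h'
        · exact h'
        · exact absurd (h1.trans_le (min_le_right _ _)) (not_lt.mpr h')
  obtain ⟨p0, hp0, hp01, hp02⟩ := h0
  choose q hqΓ hqU hq1 hq2 using fun n : ℕ => key (U n) (hU.1.mem_of_mem trivial) _ (hδ (n + 1))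
  let p : ℕ → G := fun n => Nat.casesOn n p0 q
  have hpΓ : ∀ n, p n ∈ Γ := by
    rintro (_ | n)
    · exact hp0
    · exact hqΓ n
  have hp1 : ∀ n, W ((p n)⁻¹ * g) < ε / 2 / 2 ^ n := by
    rintro (_ | n)
    · exact hp01
    · exact hq1 n
  let gs : ℕ → G := fun n => Nat.casesOn n p0 (fun n => (p n)⁻¹ * p (n + 1))
  have hprod : ∀ n, ((List.range (n + 1)).map gs).prod = p n := by
    intro n
    induction n with
    | zero => simp [gs, p]
    | succ n ih =>
      rw [List.range_succ, List.map_append, List.prod_append, ih]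
      simp [gs]
  have hb : ∀ n, W (gs (n + 1)) ≤ ε / 2 / 2 ^ n := by
    intro n
    have h := hmul ((p n)⁻¹ * g) (g⁻¹ * p (n + 1))
    have e : (p n)⁻¹ * g * (g⁻¹ * p (n + 1)) = gs (n + 1) := by simp [gs, mul_assoc]
    rw [e] at h
    refine h.trans (max_le (hp1 n).le ((hq2 n).le.trans ?_))
    gcongr
    · norm_num
    · omega
  have hs : Summable (fun i : ℕ => W (gs (i + 1))) :=
    Summable.of_nonneg_of_le (fun _ => hnonneg _) hb (summable_geometric_two' ε)
  refine ⟨gs, ?_, ?_, hs, ?_, hp02⟩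
  · rintro (_ | n)
    · exact hp0
    · exact Γ.mul_mem (Γ.inv_mem (hpΓ n)) (hpΓ (n + 1))
  · rw [← Filter.tendsto_add_atTop_iff_nat 2]
    have : (fun n => ((List.range (n + 2)).map gs).prod) = q := by
      funext n
      exact hprod (n + 1)
    rw [this]
    exact hU.tendsto hqU
  · exact (hs.tsum_le_tsum hb (summable_geometric_two' ε)).trans (tsum_geometric_two' ε).le
end
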